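/- (Anderson's lemma, centered version) Let $\xi$ be a Gaussian random vector in $\mathbb{R}^p$ with mean zero and covariance $\Sigma$, and let $A \subseteq \mathbb{R}^p$ be a convex set that is centrally symmetric (i.e., $x \in A$ implies $-x \in A$). Then for every $y \in \mathbb{R}^p$, $\mathbb{P}(\xi + y \in A) \le \mathbb{P}(\xi \in A)$. -/

import Mathlib

open MeasureTheory ProbabilityTheory
open scoped RealInnerProductSpace

/-- A probability measure `μ` on `ℝᵖ` is a centered Gaussian with covariance
operator `K` if every one-dimensional linear projection `x ↦ ⟪l, x⟫` is a
centered real Gaussian with variance `⟪l, K l⟫`. -/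
def IsCenteredGaussian {p : ℕ} (μ : Measure (EuclideanSpace ℝ (Fin p)))
    (K : EuclideanSpace ℝ (Fin p) →L[ℝ] EuclideanSpace ℝ (Fin p)) : Prop :=
  IsProbabilityMeasure μ ∧
    ∀ l : EuclideanSpace ℝ (Fin p),
      μ.map (fun x => ⟪l, x⟫) = gaussianReal 0 (⟪l, K l⟫).toNNReal

open scoped ENNReal

/-- one-dimensional Brunn-Minkowski, compact case -/
lemma bm_compact (S T U : Set ℝ) (hS : IsCompact S) (hT : IsCompact T)
    (hS0 : S.Nonempty) (hT0 : T.Nonempty)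
    (h : ∀ x ∈ S, ∀ y ∈ T, (1/2:ℝ) • (x+y) ∈ U) :
    volume S + volume T ≤ 2 * volume U := by
  obtain ⟨s, hs, hs'⟩ := hS.exists_isGreatest hS0
  obtain ⟨t, ht, ht'⟩ := hT.exists_isLeast hT0
  have h2 : volume ((fun x : ℝ => (1/2:ℝ) • x) ⁻¹' U) = 2 * volume U := by
    rw [Measure.addHaar_preimage_smul _ (by norm_num)]
    simp
  rw [← h2]
  have e1 : volume ((fun x => x + (-t)) ⁻¹' S) = volume S := measure_preimage_add_right _ _ _
  have e2 : volume ((fun x => x + (-s)) ⁻¹' T) = volume T := measure_preimage_add_right _ _ _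
  have hd : AEDisjoint volume ((fun x => x + (-t)) ⁻¹' S) ((fun x => x + (-s)) ⁻¹' T) := by
    refine measure_mono_null (t := {s + t}) ?_ (by simp)
    rintro x ⟨h1, h2⟩
    have := hs' h1
    have := ht' h2
    simp only [Set.mem_singleton_iff]
    linarith
  rw [← e1, ← e2, ← measure_union₀ (((measurable_add_const (-s)) hT.measurableSet).nullMeasurableSet) hd]
  apply measure_mono
  rintro x (hx | hx)
  · have := h _ hx _ ht
    simpa using this
  · have := h _ hs _ hx
    simpa [add_comm] using this

lemma bm (S T U : Set ℝ) (hS : MeasurableSet S) (hT : MeasurableSet T)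
    (hS0 : S.Nonempty) (hT0 : T.Nonempty)
    (h : ∀ x ∈ S, ∀ y ∈ T, (1/2:ℝ) • (x+y) ∈ U) :
    volume S + volume T ≤ 2 * volume U := by
  obtain ⟨s, hs⟩ := hS0
  obtain ⟨t, ht⟩ := hT0
  rw [hS.measure_eq_iSup_isCompact, hT.measure_eq_iSup_isCompact]
  simp only [iSup_and']
  refine ENNReal.biSup_add_biSup_le' ⟨∅, by simp⟩ ⟨∅, by simp⟩ ?_
  rintro P ⟨hP, hPc⟩ Q ⟨hQ, hQc⟩
  refine le_trans (add_le_add (measure_mono (Set.subset_insert s P)) (measure_mono (Set.subset_insert t Q))) ?_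
  refine bm_compact _ _ _ (hPc.insert s) (hQc.insert t) (Set.insert_nonempty _ _) (Set.insert_nonempty _ _) ?_
  intro x hx y hy
  exact h x (Set.insert_subset hs hP hx) y (Set.insert_subset ht hQ hy)

lemma pl_normalized (f g h : ℝ → ℝ) (hf : Measurable f) (hg : Measurable g) (hh : Measurable h)
    (f0 : ∀ x, 0 ≤ f x) (g0 : ∀ x, 0 ≤ g x) (h0 : ∀ x, 0 ≤ h x)
    (f1 : ∀ x, f x ≤ 1) (g1 : ∀ x, g x ≤ 1)
    (fs : ∀ t < 1, ∃ x, t < f x) (gs : ∀ t < 1, ∃ x, t < g x)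
    (H : ∀ x y, f x * g y ≤ h ((1/2:ℝ) • (x+y)) ^ 2) :
    (∫⁻ x, ENNReal.ofReal (f x)) + (∫⁻ x, ENNReal.ofReal (g x)) ≤ 2 * ∫⁻ x, ENNReal.ofReal (h x) := by
  rw [lintegral_eq_lintegral_meas_lt volume (.of_forall f0) hf.aemeasurable,
    lintegral_eq_lintegral_meas_lt volume (.of_forall g0) hg.aemeasurable,
    lintegral_eq_lintegral_meas_lt volume (.of_forall h0) hh.aemeasurable]
  have mm : ∀ k : ℝ → ℝ, Measurable (fun t : ℝ => volume {a | t < k a}) := fun k =>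
    Antitone.measurable (fun a b hab => measure_mono (fun x hx => lt_of_le_of_lt hab hx))
  rw [← lintegral_add_left (mm f), ← lintegral_const_mul _ (mm h)]
  refine setLIntegral_mono ((mm h).const_mul _) ?_
  intro t ht
  have ht : 0 < t := ht
  rcases lt_or_ge t 1 with h1 | h1
  · refine bm _ _ _ (measurableSet_lt measurable_const hf) (measurableSet_lt measurable_const hg)
      (fs t h1) (gs t h1) ?_
    intro x hx y hy
    simp only [Set.mem_ofPred_eq] at hx hy ⊢
    have := H x y
    refine lt_of_pow_lt_pow_left₀ 2 (h0 _) ?_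
    nlinarith
  · have a1 : {a | t < f a} = ∅ := by
      ext x; simpa using (f1 x).trans h1
    have a2 : {a | t < g a} = ∅ := by
      ext x; simpa using (g1 x).trans h1
    simp [a1, a2]

lemma amgm (a b : ℝ≥0∞) : 4 * (a * b) ≤ (a + b) ^ 2 := by
  rcases eq_or_ne a ⊤ with rfl | ha
  · simp
  rcases eq_or_ne b ⊤ with rfl | hb
  · simp
  lift a to NNReal using ha
  lift b to NNReal using hb
  norm_cast
  rw [← NNReal.coe_le_coe]
  push_cast
  nlinarith [sq_nonneg ((a:ℝ) - b)]

lemma pl_bdd (f g h : ℝ → ℝ) (hf : Measurable f) (hg : Measurable g) (hh : Measurable h)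
    (f0 : ∀ x, 0 ≤ f x) (g0 : ∀ x, 0 ≤ g x) (h0 : ∀ x, 0 ≤ h x) (M : ℝ)
    (f1 : ∀ x, f x ≤ M) (g1 : ∀ x, g x ≤ M)
    (H : ∀ x y, f x * g y ≤ h ((1/2:ℝ) • (x+y)) ^ 2) :
    (∫⁻ x, ENNReal.ofReal (f x)) * (∫⁻ x, ENNReal.ofReal (g x))
      ≤ (∫⁻ x, ENNReal.ofReal (h x)) ^ 2 := by
  have key : ∀ k : ℝ → ℝ, (∀ x, 0 ≤ k x) → (∀ x, k x ≤ M) → (∀ x, k x = 0) ∨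
      ∃ a > 0, (∀ x, k x / a ≤ 1) ∧ ∀ t < 1, ∃ x, t < k x / a := by
    intro k k0 k1
    have hb : BddAbove (Set.range k) := ⟨M, by rintro _ ⟨x, rfl⟩; exact k1 x⟩
    rcases (Real.iSup_nonneg k0).eq_or_lt with h | h
    · left
      intro x
      exact le_antisymm (h ▸ le_ciSup hb x) (k0 x)
    · right
      refine ⟨_, h, fun x => (div_le_one h).2 (le_ciSup hb x), fun t ht => ?_⟩
      obtain ⟨x, hx⟩ := exists_lt_of_lt_ciSup (show t * iSup k < iSup k by nlinarith)
      exact ⟨x, (lt_div_iff₀ h).2 hx⟩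
  rcases key f f0 f1 with hz | ⟨a, ha, fa, fs⟩
  · simp [hz]
  rcases key g g0 g1 with hz | ⟨b, hb, gb, gs⟩
  · simp [hz]
  have hab : 0 < √(a * b) := by positivity
  have := pl_normalized (fun x => f x / a) (fun x => g x / b) (fun x => h x / √(a*b))
    (hf.div_const _) (hg.div_const _) (hh.div_const _) (fun x => div_nonneg (f0 x) ha.le)
    (fun x => div_nonneg (g0 x) hb.le) (fun x => div_nonneg (h0 x) hab.le) fa gb fs gs
    (by
      intro x y
      rw [div_pow, Real.sq_sqrt (by positivity), div_mul_div_comm]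
      gcongr
      exact H x y)
  simp_rw [div_eq_mul_inv, ENNReal.ofReal_mul (f0 _), ENNReal.ofReal_mul (g0 _),
    ENNReal.ofReal_mul (h0 _)] at this
  rw [lintegral_mul_const _ hf.ennreal_ofReal, lintegral_mul_const _ hg.ennreal_ofReal,
    lintegral_mul_const _ hh.ennreal_ofReal] at this
  set F := ∫⁻ x, ENNReal.ofReal (f x)
  set G := ∫⁻ x, ENNReal.ofReal (g x)
  set I := ∫⁻ x, ENNReal.ofReal (h x)
  have h2 := (amgm _ _).trans (pow_le_pow_left' this 2)
  set c := ENNReal.ofReal ((a*b)⁻¹) with hc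
  have c1 : ENNReal.ofReal a⁻¹ * ENNReal.ofReal b⁻¹ = c := by
    rw [← ENNReal.ofReal_mul (by positivity), hc, mul_inv]
  have c2 : ENNReal.ofReal (√(a*b))⁻¹ ^ 2 = c := by
    rw [← ENNReal.ofReal_pow (by positivity), inv_pow, Real.sq_sqrt (by positivity)]
  have c0 : c ≠ 0 := by rw [hc]; exact (ENNReal.ofReal_pos.2 (by positivity)).ne'
  have ct : c ≠ ⊤ := ENNReal.ofReal_ne_top
  have h3 : (4 * c) * (F * G) ≤ (4 * c) * I ^ 2 := by
    calc (4 * c) * (F * G) = 4 * (F * ENNReal.ofReal a⁻¹ * (G * ENNReal.ofReal b⁻¹)) := by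
          rw [← c1]; ring
      _ ≤ _ := h2
      _ = _ := by rw [← c2]; ring
  exact (ENNReal.mul_le_mul_iff_right (by simp [c0]) (ENNReal.mul_ne_top (by simp) ct)).1 h3

/-- Midpoint Prékopa-Leindler property of a measure. -/
def HasPL {E : Type*} [MeasurableSpace E] [AddCommGroup E] [Module ℝ E] (μ : Measure E) : Prop :=
  ∀ f g h : E → ℝ≥0∞, Measurable f → Measurable g → Measurable h →
    (∀ x y, f x * g y ≤ h ((1/2:ℝ) • (x+y)) ^ 2) →
    (∫⁻ x, f x ∂μ) * (∫⁻ x, g x ∂μ) ≤ (∫⁻ x, h x ∂μ) ^ 2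

lemma hasPL_volume : HasPL (volume : Measure ℝ) := by
  intro f g h hf hg hh H
  have trunc : ∀ k : ℝ → ℝ≥0∞, Measurable k →
      ∫⁻ x, k x = ⨆ n : ℕ, ∫⁻ x, min (k x) n := by
    intro k hk
    rw [← lintegral_iSup (fun n => hk.min measurable_const)
      (fun a b hab x => min_le_min_left _ (by exact_mod_cast hab))]
    congr with x
    change k x = ⨆ n : ℕ, k x ⊓ (n : ℝ≥0∞)
    rw [← inf_iSup_eq, ENNReal.iSup_natCast, inf_top_eq]
  have step : ∀ n : ℕ, (∫⁻ x, min (f x) n) * (∫⁻ x, min (g x) n) ≤ (∫⁻ x, h x) ^ 2 := by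
    intro n
    have nt : ∀ a : ℝ≥0∞, min a n ≠ ⊤ := fun a => ((min_le_right _ _).trans_lt (by simp)).ne
    have := pl_bdd (fun x => (min (f x) n).toReal) (fun x => (min (g x) n).toReal)
      (fun x => (min (h x) n).toReal)
      (hf.min measurable_const).ennreal_toReal (hg.min measurable_const).ennreal_toReal
      (hh.min measurable_const).ennreal_toReal (fun _ => ENNReal.toReal_nonneg)
      (fun _ => ENNReal.toReal_nonneg) (fun _ => ENNReal.toReal_nonneg) n
      (fun x => ENNReal.toReal_le_of_le_ofReal (by simp) (by simp))
      (fun x => ENNReal.toReal_le_of_le_ofReal (by simp) (by simp))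
      (by
        intro x y
        rw [← ENNReal.toReal_mul, ← ENNReal.toReal_pow]
        refine ENNReal.toReal_mono (ENNReal.pow_ne_top (nt _)) ?_
        rcases le_total (h ((1/2:ℝ) • (x+y))) n with h1 | h1
        · rw [min_eq_left h1]
          exact (mul_le_mul' (min_le_left _ _) (min_le_left _ _)).trans (H x y)
        · rw [min_eq_right h1, sq]
          exact mul_le_mul' (min_le_right _ _) (min_le_right _ _))
    simp only [ENNReal.ofReal_toReal (nt _)] at this
    refine this.trans (pow_le_pow_left' (lintegral_mono fun x => min_le_left _ _) 2)
  have mono : ∀ k : ℝ → ℝ≥0∞, Monotone fun n : ℕ => ∫⁻ x, min (k x) n := fun k a b hab =>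
    lintegral_mono fun x => min_le_min_left _ (by exact_mod_cast hab)
  rw [trunc f hf, trunc g hg, ENNReal.iSup_mul]
  refine iSup_le fun i => ?_
  rw [ENNReal.mul_iSup]
  refine iSup_le fun j => ?_
  exact (mul_le_mul' (mono f (le_max_left i j)) (mono g (le_max_right i j))).trans (step _)

lemma hasPL_gaussianReal : HasPL (gaussianReal 0 1) := by
  intro f g h hf hg hh H
  rw [gaussianReal_of_var_ne_zero _ one_ne_zero,
    lintegral_withDensity_eq_lintegral_mul _ (measurable_gaussianPDF _ _) hf,
    lintegral_withDensity_eq_lintegral_mul _ (measurable_gaussianPDF _ _) hg,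
    lintegral_withDensity_eq_lintegral_mul _ (measurable_gaussianPDF _ _) hh]
  refine hasPL_volume _ _ _ ((measurable_gaussianPDF _ _).mul hf)
    ((measurable_gaussianPDF _ _).mul hg) ((measurable_gaussianPDF _ _).mul hh) ?_
  intro x y
  simp only [Pi.mul_apply]
  rw [mul_mul_mul_comm, mul_pow]
  refine mul_le_mul' ?_ (H x y)
  simp only [gaussianPDF]
  rw [← ENNReal.ofReal_mul (gaussianPDFReal_nonneg _ _ _), ← ENNReal.ofReal_pow (gaussianPDFReal_nonneg _ _ _)]
  apply ENNReal.ofReal_le_ofReal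
  simp only [gaussianPDFReal]
  rw [mul_mul_mul_comm, ← Real.exp_add, mul_pow, ← Real.exp_nat_mul, ← sq]
  refine mul_le_mul_of_nonneg_left (Real.exp_le_exp.2 ?_) (by positivity)
  simp
  nlinarith [sq_nonneg (x - y)]

lemma HasPL.map {E F : Type*} [MeasurableSpace E] [AddCommGroup E] [Module ℝ E]
    [MeasurableSpace F] [AddCommGroup F] [Module ℝ F] {μ : Measure E} (hμ : HasPL μ)
    (T : E → F) (hT : Measurable T)
    (hl : ∀ x y, T ((1/2:ℝ) • (x+y)) = (1/2:ℝ) • (T x + T y)) : HasPL (μ.map T) := by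
  intro f g h hf hg hh H
  rw [lintegral_map hf hT, lintegral_map hg hT, lintegral_map hh hT]
  refine hμ _ _ _ (hf.comp hT) (hg.comp hT) (hh.comp hT) fun x y => ?_
  simp only [hl]
  exact H _ _

lemma HasPL.prod {E F : Type*} [MeasurableSpace E] [AddCommGroup E] [Module ℝ E]
    [MeasurableSpace F] [AddCommGroup F] [Module ℝ F] {μ : Measure E} {ν : Measure F}
    [SFinite μ] [SFinite ν] (hμ : HasPL μ) (hν : HasPL ν) : HasPL (μ.prod ν) := by
  intro f g h hf hg hh H
  rw [lintegral_prod _ hf.aemeasurable, lintegral_prod _ hg.aemeasurable,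
    lintegral_prod _ hh.aemeasurable]
  refine hμ _ _ _ hf.lintegral_prod_right' hg.lintegral_prod_right' hh.lintegral_prod_right' ?_
  intro x y
  refine hν _ _ _ (hf.comp measurable_prodMk_left) (hg.comp measurable_prodMk_left)
    (hh.comp measurable_prodMk_left) ?_
  intro a b
  exact H (x, a) (y, b)

lemma hasPL_pi (n : ℕ) : HasPL (Measure.pi fun _ : Fin n => gaussianReal 0 1) := by
  induction n with
  | zero =>
    rw [Measure.pi_of_empty _ 0]
    intro f g h hf hg hh H
    rw [lintegral_dirac, lintegral_dirac, lintegral_dirac]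
    simpa using H 0 0
  | succ n ih =>
    have := (measurePreserving_piFinSuccAbove (fun _ : Fin (n+1) => gaussianReal 0 1) 0).symm.map_eq
    rw [← this]
    refine (hasPL_gaussianReal.prod ih).map _ (MeasurableEquiv.measurable _) ?_
    intro x y
    ext i
    refine Fin.cases ?_ (fun j => ?_) i <;>
    simp [MeasurableEquiv.piFinSuccAbove_symm_apply, Fin.insertNthEquiv, mul_add]

lemma charFun_of_isCenteredGaussian {p : ℕ} {μ : Measure (EuclideanSpace ℝ (Fin p))}
    {K : EuclideanSpace ℝ (Fin p) →L[ℝ] EuclideanSpace ℝ (Fin p)}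
    (hKpsd : ∀ x, 0 ≤ ⟪x, K x⟫)
    (hμ : IsCenteredGaussian μ K) (t : EuclideanSpace ℝ (Fin p)) :
    charFun μ t = Complex.exp (-(⟪t, K t⟫ : ℝ) / 2) := by
  have h1 : charFun μ t = charFun (μ.map (fun x => ⟪t, x⟫)) 1 := by
    rw [charFun_apply, charFun_apply, integral_map (by fun_prop) (by fun_prop)]
    simp [real_inner_comm]
  rw [h1, hμ.2 t, charFun_gaussianReal]
  simp [Real.coe_toNNReal _ (hKpsd t), neg_div]

lemma hasPL_of_isCenteredGaussian {p : ℕ} {μ : Measure (EuclideanSpace ℝ (Fin p))}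
    {K : EuclideanSpace ℝ (Fin p) →L[ℝ] EuclideanSpace ℝ (Fin p)}
    (hKsymm : ∀ x y, ⟪K x, y⟫ = ⟪x, K y⟫)
    (hKpsd : ∀ x, 0 ≤ ⟪x, K x⟫)
    (hμ : IsCenteredGaussian μ K) : HasPL μ := by
  have := hμ.1
  obtain ⟨S, hS⟩ := (Matrix.toEuclideanCLM (n := Fin p) (𝕜 := ℝ)).surjective K
  change Matrix.toEuclideanCLM (n := Fin p) (𝕜 := ℝ) S = K at hS
  have hpos : S.PosSemidef := by
    rw [← Matrix.isPositive_toEuclideanLin_iff, ← Matrix.coe_toEuclideanCLM_eq_toEuclideanLin, hS]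
    refine ⟨fun x y => hKsymm x y, fun x => ?_⟩
    simpa [real_inner_comm] using hKpsd x
  have hμ' : μ = multivariateGaussian 0 S := by
    apply Measure.ext_of_charFun
    ext t
    rw [charFun_of_isCenteredGaussian hKpsd hμ, charFun_multivariateGaussian hpos, ← hS,
      Matrix.inner_toEuclideanCLM]
    simp [neg_div]
  rw [hμ', multivariateGaussian, stdGaussian]
  refine HasPL.map (HasPL.map (hasPL_pi _) _ (by fun_prop) ?_) _ (by fun_prop) ?_
  · intro x y
    simp [← Finset.sum_add_distrib, Finset.smul_sum, add_smul, smul_smul, mul_add]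
  · intro x y
    simp

lemma map_neg_of_isCenteredGaussian {p : ℕ} {μ : Measure (EuclideanSpace ℝ (Fin p))}
    {K : EuclideanSpace ℝ (Fin p) →L[ℝ] EuclideanSpace ℝ (Fin p)}
    (hKpsd : ∀ x, 0 ≤ ⟪x, K x⟫)
    (hμ : IsCenteredGaussian μ K) : μ.map (fun x => -x) = μ := by
  have := hμ.1
  have e : (fun x : EuclideanSpace ℝ (Fin p) => -x) = fun x => (-1 : ℝ) • x := by
    ext x; simp
  rw [e]
  have : IsProbabilityMeasure (μ.map fun x => (-1 : ℝ) • x) :=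
    Measure.isProbabilityMeasure_map (by fun_prop)
  apply Measure.ext_of_charFun
  ext t
  rw [charFun_map_smul, charFun_of_isCenteredGaussian hKpsd hμ,
    charFun_of_isCenteredGaussian hKpsd hμ]
  simp

/-- Anderson's lemma: if `ξ ~ N(0, Σ)` on `ℝᵖ` and `A` is a
centrally symmetric convex set, then `P(ξ + y ∈ A) ≤ P(ξ ∈ A)` for all `y`. -/
theorem stmt_13 (p : ℕ) (μ : Measure (EuclideanSpace ℝ (Fin p)))
    (K : EuclideanSpace ℝ (Fin p) →L[ℝ] EuclideanSpace ℝ (Fin p))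
    (hKsymm : ∀ x y, ⟪K x, y⟫ = ⟪x, K y⟫)
    (hKpsd : ∀ x, 0 ≤ ⟪x, K x⟫)
    (hμ : IsCenteredGaussian μ K)
    (A : Set (EuclideanSpace ℝ (Fin p))) (hAmeas : MeasurableSet A)
    (hAconv : Convex ℝ A) (hAsymm : ∀ x ∈ A, -x ∈ A) :
    ∀ y : EuclideanSpace ℝ (Fin p), μ {x | x + y ∈ A} ≤ μ A := by
  intro y
  have hPL := hasPL_of_isCenteredGaussian hKsymm hKpsd hμ
  have hneg := map_neg_of_isCenteredGaussian hKpsd hμ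
  have m1 : MeasurableSet {x | x + y ∈ A} := (measurable_add_const y) hAmeas
  have m2 : MeasurableSet {x | x - y ∈ A} := (measurable_sub_const y) hAmeas
  have hsym : μ {x | x - y ∈ A} = μ {x | x + y ∈ A} := by
    conv_lhs => rw [← hneg]
    rw [Measure.map_apply measurable_neg m2]
    congr 1
    ext x
    simp only [Set.mem_preimage, Set.mem_ofPred_eq]
    constructor
    · intro h
      have := hAsymm _ h
      rwa [neg_sub, sub_neg_eq_add, add_comm] at this
    · intro h
      have := hAsymm _ h
      rwa [neg_add, ← sub_eq_add_neg] at this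
  have key := hPL ({x | x + y ∈ A}.indicator 1) ({x | x - y ∈ A}.indicator 1) (A.indicator 1)
    (measurable_one.indicator m1) (measurable_one.indicator m2) (measurable_one.indicator hAmeas)
    (by
      intro a b
      by_cases ha : a + y ∈ A
      · by_cases hb : b - y ∈ A
        · have : (1/2:ℝ) • (a + b) ∈ A := by
            have := hAconv ha hb (a := 1/2) (b := 1/2) (by norm_num) (by norm_num) (by norm_num)
            convert this using 1
            module
          simp only [Set.indicator_of_mem this]
          simp [ha, hb]
        · simp [Set.indicator, hb]
      · simp [Set.indicator, ha])
  rw [lintegral_indicator_one m1, lintegral_indicator_one m2, lintegral_indicator_one hAmeas,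
    hsym, ← sq] at key
  exact (ENNReal.pow_le_pow_left_iff two_ne_zero).1 key
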